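/- arXiv:1905.01083 — 7 statements merged into one kernel-verified Lean document; each statement's English description precedes it below -/
import Mathlib

section
/- Let (E,d) be a complete separable metric space equipped with its Borel σ-algebra, let p ≥ 1 and C ≥ 0, and let (μ_n) be a sequence of Borel probability measures on E, each satisfying the transportation inequality T_p(C). If μ_n converges weakly to a Borel probability measure μ (i.e. ∫ f dμ_n → ∫ f dμ for every bounded continuous f : E → ℝ), then μ satisfies T_p(C). -/
open MeasureTheory
open scoped ENNReal NNReal

/-- The Wasserstein distance of order `p` between two measures on a (pseudo-e)metric space:
the infimum over all couplings `π` of `μ` and `ν` of `(∫ d(x,y)^p dπ)^(1/p)`. -/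
noncomputable def wassersteinDist {E : Type*} [PseudoEMetricSpace E] [MeasurableSpace E]
    (p : ℝ) (μ ν : Measure E) : ℝ≥0∞ :=
  ⨅ π ∈ {π : Measure (E × E) | π.map Prod.fst = μ ∧ π.map Prod.snd = ν},
    (∫⁻ z, edist z.1 z.2 ^ p ∂π) ^ (1 / p)

open Classical in
/-- The relative entropy `H(ν|μ) = ∫ log (dν/dμ) dν` if `ν ≪ μ` (and the integral exists),
and `+∞` otherwise. -/
noncomputable def relEntropy {E : Type*} [MeasurableSpace E] (ν μ : Measure E) : ℝ≥0∞ :=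
  if ν ≪ μ ∧ Integrable (fun x => Real.log (ν.rnDeriv μ x).toReal) ν then
    ENNReal.ofReal (∫ x, Real.log (ν.rnDeriv μ x).toReal ∂ν)
  else ⊤

/-- A probability measure `μ` satisfies the transportation inequality `T_p(C)` if
`W_p(μ,ν) ≤ √(2 C H(ν|μ))` for every probability measure `ν`. -/
def SatisfiesTp {E : Type*} [PseudoEMetricSpace E] [MeasurableSpace E]
    (p C : ℝ) (μ : Measure E) : Prop :=
  ∀ ν : Measure E, IsProbabilityMeasure ν →
    wassersteinDist p μ ν ≤ (ENNReal.ofReal (2 * C) * relEntropy ν μ) ^ (1 / 2 : ℝ)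

open Filter Topology BoundedContinuousFunction

theorem lintegral_edist_rpow_le_of_tendsto {E ι : Type*} [MetricSpace E]
    [SecondCountableTopology E] [MeasurableSpace E] [BorelSpace E] {p : ℝ} (hp : 0 ≤ p)
    {l : Filter ι} [l.NeBot] {πs : ι → ProbabilityMeasure (E × E)} {π : ProbabilityMeasure (E × E)}
    (hπ : Tendsto πs l (𝓝 π)) {B : ℝ≥0∞}
    (hB : ∀ᶠ i in l, ∫⁻ z, edist z.1 z.2 ^ p ∂(πs i : Measure (E × E)) ≤ B) :
    ∫⁻ z, edist z.1 z.2 ^ p ∂(π : Measure (E × E)) ≤ B := by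
  have hcont : Continuous fun z : E × E => nndist z.1 z.2 ^ p :=
    (NNReal.continuous_rpow_const hp).comp continuous_nndist
  have hed : ∀ z : E × E, edist z.1 z.2 ^ p = ((nndist z.1 z.2 ^ p : ℝ≥0) : ℝ≥0∞) := fun z => by
    rw [edist_nndist, ENNReal.coe_rpow_of_nonneg _ hp]
  let h : ℕ → (E × E →ᵇ ℝ≥0) := fun M =>
    BoundedContinuousFunction.mkOfBound
      ⟨fun z => min (nndist z.1 z.2 ^ p) (M : ℝ≥0), hcont.min continuous_const⟩ M fun x y => by
        refine (NNReal.dist_eq _ _).trans_le (abs_sub_le_iff.2 ⟨?_, ?_⟩)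
        · exact (sub_le_self _ (NNReal.coe_nonneg _)).trans (by exact_mod_cast min_le_right _ _)
        · exact (sub_le_self _ (NNReal.coe_nonneg _)).trans (by exact_mod_cast min_le_right _ _)
  have hle : ∀ M, ∫⁻ z, h M z ∂(π : Measure (E × E)) ≤ B := fun M => by
    refine le_of_tendsto (ProbabilityMeasure.tendsto_iff_forall_lintegral_tendsto.1 hπ (h M)) ?_
    filter_upwards [hB] with i hi
    refine (lintegral_mono fun z => ?_).trans hi
    rw [hed]
    exact ENNReal.coe_le_coe.2 (min_le_left _ _)
  have hsup : ∀ z : E × E, edist z.1 z.2 ^ p = ⨆ M, (h M z : ℝ≥0∞) := fun z => by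
    rw [hed]
    refine le_antisymm ?_ (iSup_le fun M => ENNReal.coe_le_coe.2 (min_le_left _ _))
    obtain ⟨M, hM⟩ := exists_nat_ge (nndist z.1 z.2 ^ p)
    exact le_iSup_of_le M (ENNReal.coe_le_coe.2 (le_min le_rfl hM))
  simp only [hsup]
  rw [lintegral_iSup (fun M => (h M).continuous.measurable.coe_nnreal_ennreal)
    fun M N hMN z => ENNReal.coe_le_coe.2 (min_le_min le_rfl (by exact_mod_cast hMN))]
  exact iSup_le hle

theorem wassersteinDist_le_of_tendsto {E : Type*} [MetricSpace E] [CompleteSpace E]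
    [SecondCountableTopology E] [MeasurableSpace E] [BorelSpace E] {p : ℝ} (hp : 0 < p)
    {μs νs : ℕ → ProbabilityMeasure E} {μ ν : ProbabilityMeasure E}
    (hμ : Tendsto μs atTop (𝓝 μ)) (hν : Tendsto νs atTop (𝓝 ν))
    {a : ℕ → ℝ≥0∞} {A : ℝ≥0∞} (ha : Tendsto a atTop (𝓝 A))
    (h : ∀ᶠ n in atTop, wassersteinDist p (μs n : Measure E) (νs n) ≤ a n) :
    wassersteinDist p (μ : Measure E) ν ≤ A := by
  refine le_of_forall_gt_imp_ge_of_dense fun b hb => ?_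
  obtain ⟨N, hN⟩ := eventually_atTop.1 (h.and (ha.eventually_lt_const hb))
  have key : ∀ n, ∃ π : ProbabilityMeasure (E × E),
      (π : Measure (E × E)).map Prod.fst = μs (n + N) ∧
      (π : Measure (E × E)).map Prod.snd = νs (n + N) ∧
      ∫⁻ z, edist z.1 z.2 ^ p ∂(π : Measure (E × E)) ≤ b ^ p := by
    intro n
    obtain ⟨h1, h2⟩ := hN (n + N) (by omega)
    have h3 := h1.trans_lt h2
    simp only [wassersteinDist, iInf_lt_iff] at h3
    obtain ⟨π, ⟨hπ1, hπ2⟩, h3⟩ := h3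
    have : IsProbabilityMeasure π := by
      constructor
      have : (π.map Prod.fst) Set.univ = 1 := by rw [hπ1]; exact measure_univ
      rwa [Measure.map_apply measurable_fst MeasurableSet.univ, Set.preimage_univ] at this
    refine ⟨⟨π, this⟩, hπ1, hπ2, ?_⟩
    rw [one_div] at h3
    exact (ENNReal.rpow_inv_le_iff hp).1 h3.le
  choose π hπ1 hπ2 hπ3 using key
  have htight : ∀ {ρs : ℕ → ProbabilityMeasure E} {ρ : ProbabilityMeasure E},
      Tendsto ρs atTop (𝓝 ρ) →
      IsTightMeasureSet {((m : ProbabilityMeasure E) : Measure E) | m ∈ Set.range ρs} :=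
    fun hρ => isTightMeasureSet_of_isCompact_closure
      (hρ.isCompact_insert_range.closure_of_subset (Set.subset_insert _ _))
  have hT : IsTightMeasureSet
      {((m : ProbabilityMeasure (E × E)) : Measure (E × E)) | m ∈ Set.range π} := by
    refine IsTightMeasureSet.prodMk ((htight hμ).subset ?_) ((htight hν).subset ?_)
    · rintro _ ⟨_, ⟨_, ⟨n, rfl⟩, rfl⟩, rfl⟩
      exact ⟨_, ⟨n + N, rfl⟩, (hπ1 n).symm⟩
    · rintro _ ⟨_, ⟨_, ⟨n, rfl⟩, rfl⟩, rfl⟩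
      exact ⟨_, ⟨n + N, rfl⟩, (hπ2 n).symm⟩
  let U : Ultrafilter ℕ := Ultrafilter.of atTop
  have hU : (U : Filter ℕ) ≤ atTop := Ultrafilter.of_le atTop
  have hUπ : ((U.map π : Ultrafilter _) : Filter (ProbabilityMeasure (E × E))) ≤
      𝓟 (closure (Set.range π)) := by
    rw [le_principal_iff]
    exact mem_of_superset (mem_map.2 (univ_mem' fun n => Set.mem_range_self n)) subset_closure
  obtain ⟨π₀, -, hπ₀⟩ :=
    (isCompact_closure_of_isTightMeasureSet hT).ultrafilter_le_nhds (U.map π) hUπ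
  have hlim : Tendsto π U (𝓝 π₀) := hπ₀
  have hshift : Tendsto (fun n => n + N) (U : Filter ℕ) atTop :=
    (tendsto_add_atTop_nat N).mono_left hU
  have e1 : π₀.map (continuous_fst.measurable.aemeasurable) = μ := by
    refine tendsto_nhds_unique (ProbabilityMeasure.tendsto_map_of_tendsto_of_continuous _ _ hlim
      continuous_fst) ((hμ.comp hshift).congr fun n => ?_)
    exact Subtype.ext (hπ1 n).symm
  have e2 : π₀.map (continuous_snd.measurable.aemeasurable) = ν := by
    refine tendsto_nhds_unique (ProbabilityMeasure.tendsto_map_of_tendsto_of_continuous _ _ hlim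
      continuous_snd) ((hν.comp hshift).congr fun n => ?_)
    exact Subtype.ext (hπ2 n).symm
  have hcost := lintegral_edist_rpow_le_of_tendsto hp.le hlim (Eventually.of_forall hπ3)
  have hmem : (π₀ : Measure (E × E)) ∈ {π : Measure (E × E) |
      π.map Prod.fst = μ ∧ π.map Prod.snd = ν} :=
    ⟨congrArg Subtype.val e1, congrArg Subtype.val e2⟩
  refine (iInf₂_le _ hmem).trans ?_
  rw [one_div]
  exact (ENNReal.rpow_inv_le_iff hp).2 hcost

/-- The probability measure with density proportional to `g` with respect to `μ`. -/
noncomputable def normalizedDensity {E : Type*} [MeasurableSpace E] (μ : Measure E) (g : E → ℝ) :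
    Measure E :=
  μ.withDensity fun x => ENNReal.ofReal (g x / ∫ y, g y ∂μ)

section NormalizedDensity

variable {E : Type*} [MeasurableSpace E] {μ : Measure E} {g : E → ℝ}

theorem isProbabilityMeasure_normalizedDensity (hg0 : ∀ x, 0 ≤ g x)
    (hgi : Integrable g μ) (hZ : 0 < ∫ x, g x ∂μ) :
    IsProbabilityMeasure (normalizedDensity μ g) := by
  constructor
  rw [normalizedDensity, withDensity_apply _ MeasurableSet.univ, Measure.restrict_univ,
    ← ofReal_integral_eq_lintegral_ofReal (hgi.div_const _)
      (Eventually.of_forall fun x => div_nonneg (hg0 x) hZ.le), integral_div, div_self hZ.ne',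
    ENNReal.ofReal_one]

theorem integral_normalizedDensity (hg : Measurable g) (hg0 : ∀ x, 0 ≤ g x)
    (hZ : 0 < ∫ x, g x ∂μ) (f : E → ℝ) :
    ∫ x, f x ∂(normalizedDensity μ g) = (∫ x, g x * f x ∂μ) / ∫ x, g x ∂μ := by
  rw [normalizedDensity, integral_withDensity_eq_integral_toReal_smul (by fun_prop)
    (Eventually.of_forall fun x => ENNReal.ofReal_lt_top), ← integral_div]
  refine integral_congr_ae (Eventually.of_forall fun x => ?_)
  simp only [smul_eq_mul]
  rw [ENNReal.toReal_ofReal (div_nonneg (hg0 x) hZ.le)]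
  ring

theorem relEntropy_normalizedDensity [SigmaFinite μ] (hg : Measurable g) (hg0 : ∀ x, 0 ≤ g x)
    (hgi : Integrable g μ) (hgl : Integrable (fun x => g x * Real.log (g x)) μ)
    (hZ : 0 < ∫ x, g x ∂μ) :
    relEntropy (normalizedDensity μ g) μ =
      ENNReal.ofReal ((∫ x, g x * Real.log (g x) ∂μ) / (∫ x, g x ∂μ)
        - Real.log (∫ x, g x ∂μ)) := by
  set Z := ∫ x, g x ∂μ with hZdef
  have hac : normalizedDensity μ g ≪ μ := withDensity_absolutelyContinuous _ _
  have hrn : (fun x => Real.log ((normalizedDensity μ g).rnDeriv μ x).toReal)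
      =ᵐ[normalizedDensity μ g] fun x => Real.log (g x / Z) := by
    refine hac.ae_le ?_
    filter_upwards [Measure.rnDeriv_withDensity μ
      (f := fun x => ENNReal.ofReal (g x / Z)) (by fun_prop)] with x hx
    rw [normalizedDensity, ← hZdef, hx, ENNReal.toReal_ofReal (div_nonneg (hg0 x) hZ.le)]
  have hpt : ∀ x, g x * Real.log (g x / Z) = g x * Real.log (g x) - g x * Real.log Z := by
    intro x
    rcases (hg0 x).eq_or_lt with h | h
    · simp [← h]
    · rw [Real.log_div h.ne' hZ.ne']; ring
  have hint : Integrable (fun x => Real.log (g x / Z)) (normalizedDensity μ g) := by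
    rw [normalizedDensity, integrable_withDensity_iff_integrable_smul' (by fun_prop)
      (Eventually.of_forall fun x => ENNReal.ofReal_lt_top)]
    refine ((hgl.sub (hgi.mul_const (Real.log Z))).div_const Z).congr
      (Eventually.of_forall fun x => ?_)
    simp only [Pi.sub_apply, smul_eq_mul, ← hpt, ← hZdef]
    rw [ENNReal.toReal_ofReal (div_nonneg (hg0 x) hZ.le)]
    ring
  rw [relEntropy, if_pos ⟨hac, hint.congr hrn.symm⟩, integral_congr_ae hrn,
    integral_normalizedDensity hg hg0 hZ]
  simp only [hpt]
  rw [integral_sub hgl (hgi.mul_const _), integral_mul_const, ← hZdef, sub_div,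
    mul_div_cancel_left₀ _ hZ.ne']

end NormalizedDensity

/-- The inequality `T_p(C)` for `μ` tested against the probability with density proportional
to `g`. -/
def DensityTp {E : Type*} [PseudoEMetricSpace E] [MeasurableSpace E]
    (p C : ℝ) (μ : Measure E) (g : E → ℝ) : Prop :=
  wassersteinDist p μ (normalizedDensity μ g) ≤
    (ENNReal.ofReal (2 * C) * ENNReal.ofReal ((∫ x, g x * Real.log (g x) ∂μ) / (∫ x, g x ∂μ)
        - Real.log (∫ x, g x ∂μ))) ^ (1 / 2 : ℝ)

section Limits

variable {E : Type*} [MetricSpace E] [CompleteSpace E] [SecondCountableTopology E]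
  [MeasurableSpace E] [BorelSpace E] {p C : ℝ}

theorem DensityTp.of_tendsto (hp : 0 < p)
    {μs : ℕ → ProbabilityMeasure E} {μ : ProbabilityMeasure E} (hμ : Tendsto μs atTop (𝓝 μ))
    {gs : ℕ → E → ℝ} {g : E → ℝ} (hgs : ∀ n, Measurable (gs n)) (hg : Measurable g)
    (hgs0 : ∀ n x, 0 ≤ gs n x) (hg0 : ∀ x, 0 ≤ g x)
    (hgsi : ∀ n, Integrable (gs n) (μs n : Measure E)) (hgi : Integrable g (μ : Measure E))
    (hZ : 0 < ∫ x, g x ∂(μ : Measure E))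
    (hlim : ∀ f : E →ᵇ ℝ, Tendsto (fun n => ∫ x, gs n x * f x ∂(μs n : Measure E)) atTop
      (𝓝 (∫ x, g x * f x ∂(μ : Measure E))))
    (hent : Tendsto (fun n => ∫ x, gs n x * Real.log (gs n x) ∂(μs n : Measure E)) atTop
      (𝓝 (∫ x, g x * Real.log (g x) ∂(μ : Measure E))))
    (h : ∀ n, 0 < ∫ x, gs n x ∂(μs n : Measure E) → DensityTp p C (μs n : Measure E) (gs n)) :
    DensityTp p C (μ : Measure E) g := by
  have hlimZ : Tendsto (fun n => ∫ x, gs n x ∂(μs n : Measure E)) atTop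
      (𝓝 (∫ x, g x ∂(μ : Measure E))) := by
    simpa using hlim (BoundedContinuousFunction.const E 1)
  obtain ⟨N, hN⟩ := eventually_atTop.1 (hlimZ.eventually_const_lt hZ)
  have hN' : ∀ n, 0 < ∫ x, gs (n + N) x ∂(μs (n + N) : Measure E) := fun n => hN _ (by omega)
  have hshift := tendsto_add_atTop_nat N
  let νs : ℕ → ProbabilityMeasure E := fun n => ⟨normalizedDensity (μs (n + N)) (gs (n + N)),
    isProbabilityMeasure_normalizedDensity (hgs0 _) (hgsi _) (hN' n)⟩
  let ν : ProbabilityMeasure E := ⟨normalizedDensity μ g,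
    isProbabilityMeasure_normalizedDensity hg0 hgi hZ⟩
  have hν : Tendsto νs atTop (𝓝 ν) := by
    rw [ProbabilityMeasure.tendsto_iff_forall_integral_tendsto]
    intro f
    have e : ∀ n, ∫ x, f x ∂(νs n : Measure E) = _ :=
      fun n => integral_normalizedDensity (hgs _) (hgs0 _) (hN' n) f
    have e' : ∫ x, f x ∂(ν : Measure E) = _ := integral_normalizedDensity hg hg0 hZ f
    simp only [e, e']
    exact ((hlim f).div hlimZ hZ.ne').comp hshift
  refine wassersteinDist_le_of_tendsto hp (hμ.comp hshift) hν ?_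
    (Eventually.of_forall fun n => h (n + N) (hN' n))
  have hr := (((hent.div hlimZ hZ.ne').sub (hlimZ.log hZ.ne')).comp hshift)
  exact (ENNReal.continuous_rpow_const.tendsto _).comp
    (ENNReal.Tendsto.const_mul (ENNReal.tendsto_ofReal hr) (Or.inr ENNReal.ofReal_ne_top))

theorem DensityTp.of_dominated (hp : 0 < p) {μ : ProbabilityMeasure E}
    {gs : ℕ → E → ℝ} {g : E → ℝ} (hgs : ∀ n, Measurable (gs n)) (hg : Measurable g)
    (hgs0 : ∀ n x, 0 ≤ gs n x) (hg0 : ∀ x, 0 ≤ g x)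
    {G H : E → ℝ} (hG : Integrable G (μ : Measure E)) (hH : Integrable H (μ : Measure E))
    (hgi : Integrable g (μ : Measure E))
    (hGs : ∀ n x, gs n x ≤ G x) (hHs : ∀ n x, |gs n x * Real.log (gs n x)| ≤ H x)
    (hae : ∀ᵐ x ∂(μ : Measure E), Tendsto (fun n => gs n x) atTop (𝓝 (g x)))
    (hZ : 0 < ∫ x, g x ∂(μ : Measure E))
    (h : ∀ n, 0 < ∫ x, gs n x ∂(μ : Measure E) → DensityTp p C (μ : Measure E) (gs n)) :
    DensityTp p C (μ : Measure E) g := by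
  refine DensityTp.of_tendsto hp (tendsto_const_nhds (x := μ)) hgs hg hgs0 hg0 (fun n => ?_) hgi hZ
    (fun f => ?_) ?_ h
  · refine hG.mono' (hgs n).aestronglyMeasurable (Eventually.of_forall fun x => ?_)
    rw [Real.norm_of_nonneg (hgs0 n x)]
    exact hGs n x
  · refine tendsto_integral_of_dominated_convergence (fun x => G x * ‖f‖)
      (fun n => ((hgs n).mul f.continuous.measurable).aestronglyMeasurable) (hG.mul_const _)
      (fun n => Eventually.of_forall fun x => ?_) ?_
    · rw [norm_mul, Real.norm_of_nonneg (hgs0 n x)]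
      exact mul_le_mul (hGs n x) (f.norm_coe_le_norm x) (norm_nonneg _)
        ((hgs0 n x).trans (hGs n x))
    · filter_upwards [hae] with x hx using hx.mul_const _
  · refine tendsto_integral_of_dominated_convergence H
      (fun n => (Real.continuous_mul_log.measurable.comp (hgs n)).aestronglyMeasurable) hH
      (fun n => Eventually.of_forall fun x => hHs n x) ?_
    filter_upwards [hae] with x hx using (Real.continuous_mul_log.tendsto _).comp hx

theorem exists_forall_abs_mul_log_le (M : ℝ) :
    ∃ K, ∀ x, 0 ≤ x → x ≤ M → |x * Real.log x| ≤ K := by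
  obtain ⟨K, hK⟩ := (isCompact_Icc (a := (0 : ℝ)) (b := M)).exists_bound_of_continuousOn
    Real.continuous_mul_log.continuousOn
  exact ⟨K, fun x h0 hM => hK x ⟨h0, hM⟩⟩

theorem DensityTp.of_continuous (hp : 0 < p)
    {μs : ℕ → ProbabilityMeasure E} {μ : ProbabilityMeasure E} (hμ : Tendsto μs atTop (𝓝 μ))
    (hT : ∀ n, SatisfiesTp p C (μs n : Measure E)) {g : E → ℝ} (hg : Continuous g)
    (hg0 : ∀ x, 0 ≤ g x) {M : ℝ} (hgM : ∀ x, g x ≤ M) (hZ : 0 < ∫ x, g x ∂(μ : Measure E)) :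
    DensityTp p C (μ : Measure E) g := by
  obtain ⟨K, hK⟩ := exists_forall_abs_mul_log_le M
  have hlog : Continuous fun x => g x * Real.log (g x) := Real.continuous_mul_log.comp hg
  have hi : ∀ ρ : ProbabilityMeasure E, Integrable g (ρ : Measure E) := fun ρ =>
    Integrable.of_bound hg.aestronglyMeasurable M (Eventually.of_forall fun x => by
      rw [Real.norm_of_nonneg (hg0 x)]; exact hgM x)
  have hli : ∀ ρ : ProbabilityMeasure E,
      Integrable (fun x => g x * Real.log (g x)) (ρ : Measure E) := fun ρ =>
    Integrable.of_bound hlog.aestronglyMeasurable K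
      (Eventually.of_forall fun x => hK _ (hg0 x) (hgM x))
  rw [ProbabilityMeasure.tendsto_iff_forall_integral_tendsto] at hμ
  have hweak : ∀ f : E → ℝ, Continuous f → (∃ K, ∀ x, ‖f x‖ ≤ K) →
      Tendsto (fun n => ∫ x, f x ∂(μs n : Measure E)) atTop (𝓝 (∫ x, f x ∂(μ : Measure E))) :=
    fun f hf ⟨K, hK⟩ => hμ (BoundedContinuousFunction.ofNormedAddCommGroup f hf K hK)
  refine DensityTp.of_tendsto hp (ProbabilityMeasure.tendsto_iff_forall_integral_tendsto.2 hμ)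
    (fun _ => hg.measurable) hg.measurable (fun _ => hg0) hg0 (fun n => hi _) (hi _) hZ
    (fun f => ?_) ?_ fun n hn => ?_
  · refine hweak _ (hg.mul f.continuous) ⟨M * ‖f‖, fun x => ?_⟩
    rw [norm_mul, Real.norm_of_nonneg (hg0 x)]
    exact mul_le_mul (hgM x) (f.norm_coe_le_norm x) (norm_nonneg _) ((hg0 x).trans (hgM x))
  · exact hweak _ hlog ⟨K, fun x => hK _ (hg0 x) (hgM x)⟩
  · rw [DensityTp, ← relEntropy_normalizedDensity hg.measurable hg0 (hi _) (hli _) hn]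
    exact hT n _ (isProbabilityMeasure_normalizedDensity hg0 (hi _) hn)

theorem DensityTp.of_bounded (hp : 0 < p) {μ : ProbabilityMeasure E}
    (h : ∀ g : E → ℝ, Continuous g → (∀ x, 0 ≤ g x) → (∃ M, ∀ x, g x ≤ M) →
      0 < ∫ x, g x ∂(μ : Measure E) → DensityTp p C (μ : Measure E) g)
    {g : E → ℝ} (hg : Measurable g)
    (hg0 : ∀ x, 0 ≤ g x) {M : ℝ} (hgM : ∀ x, g x ≤ M) (hZ : 0 < ∫ x, g x ∂(μ : Measure E)) :
    DensityTp p C (μ : Measure E) g := by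
  obtain ⟨K, hK⟩ := exists_forall_abs_mul_log_le M
  have hi : Integrable g (μ : Measure E) :=
    Integrable.of_bound hg.aestronglyMeasurable M (Eventually.of_forall fun x => by
      rw [Real.norm_of_nonneg (hg0 x)]; exact hgM x)
  have hne : ∃ x : E, True := by
    by_contra! hE
    have : IsEmpty E := ⟨fun x => hE x⟩
    simp [integral_of_isEmpty] at hZ
  have hM : 0 ≤ M := hne.elim fun x _ => (hg0 x).trans (hgM x)
  obtain ⟨u, -, hu, hu0⟩ := exists_seq_strictAnti_tendsto' (zero_lt_one (α := ℝ≥0∞))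
  have happ : ∀ n, ∃ f : E →ᵇ ℝ, eLpNorm (⇑f - g) 1 (μ : Measure E) ≤ u n := fun n => by
    obtain ⟨f, hf, -⟩ := (memLp_one_iff_integrable.2 hi).exists_boundedContinuous_eLpNorm_sub_le
      ENNReal.one_ne_top (hu n).1.ne'
    exact ⟨f, by rwa [eLpNorm_sub_comm]⟩
  choose f hf using happ
  have hf0 : Tendsto (fun n => eLpNorm (⇑(f n) - g) 1 (μ : Measure E)) atTop (𝓝 0) :=
    tendsto_of_tendsto_of_tendsto_of_le_of_le tendsto_const_nhds hu0 (fun _ => bot_le) hf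
  obtain ⟨φ, -, hφ⟩ := (tendstoInMeasure_of_tendsto_eLpNorm one_ne_zero
    (fun n => (f n).continuous.aestronglyMeasurable) hg.aestronglyMeasurable
    hf0).exists_seq_tendsto_ae
  have hcont : ∀ n, Continuous fun x => max 0 (min (f (φ n) x) M) := fun n =>
    continuous_const.max ((f (φ n)).continuous.min continuous_const)
  have hle : ∀ n x, max 0 (min (f (φ n) x) M) ≤ M := fun n x => max_le hM (min_le_right _ _)
  refine DensityTp.of_dominated hp (gs := fun n x => max 0 (min (f (φ n) x) M))
    (G := fun _ => M) (H := fun _ => K) (fun n => (hcont n).measurable) hg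
    (fun n x => le_max_left _ _) hg0 (integrable_const _) (integrable_const _) hi hle
    (fun n x => hK _ (le_max_left _ _) (hle n x)) ?_ hZ
    fun n hn => h _ (hcont n) (fun x => le_max_left _ _) ⟨M, hle n⟩ hn
  filter_upwards [hφ] with x hx
  have := (tendsto_const_nhds (x := (0 : ℝ))).max (hx.min (tendsto_const_nhds (x := M)))
  rwa [min_eq_left (hgM x), max_eq_right (hg0 x)] at this

theorem abs_min_mul_log_le {x M : ℝ} (hM : 1 ≤ M) :
    |min x M * Real.log (min x M)| ≤ |x * Real.log x| := by
  rcases le_total x M with h | h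
  · rw [min_eq_left h]
  · rw [min_eq_right h, abs_of_nonneg (mul_nonneg (by linarith) (Real.log_nonneg hM)),
      abs_of_nonneg (mul_nonneg (by linarith) (Real.log_nonneg (hM.trans h)))]
    exact mul_le_mul h (Real.log_le_log (by linarith) h) (Real.log_nonneg hM) (by linarith)

theorem DensityTp.of_integrable (hp : 0 < p) {μ : ProbabilityMeasure E}
    (h : ∀ g : E → ℝ, Measurable g → (∀ x, 0 ≤ g x) → (∃ M, ∀ x, g x ≤ M) →
      0 < ∫ x, g x ∂(μ : Measure E) → DensityTp p C (μ : Measure E) g)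
    {g : E → ℝ} (hg : Measurable g) (hg0 : ∀ x, 0 ≤ g x) (hi : Integrable g (μ : Measure E))
    (hl : Integrable (fun x => g x * Real.log (g x)) (μ : Measure E))
    (hZ : 0 < ∫ x, g x ∂(μ : Measure E)) :
    DensityTp p C (μ : Measure E) g := by
  have h0 : ∀ (n : ℕ) x, 0 ≤ min (g x) ((n : ℝ) + 1) := fun n x => le_min (hg0 x) (by positivity)
  refine DensityTp.of_dominated hp (gs := fun n x => min (g x) ((n : ℝ) + 1))
    (fun n => hg.min measurable_const) hg h0 hg0 hi hl.abs hi
    (fun n x => min_le_left _ _) (fun n x => abs_min_mul_log_le (by simp)) ?_ hZ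
    fun n hn => h _ (hg.min measurable_const) (h0 n) ⟨_, fun x => min_le_right _ _⟩ hn
  refine Eventually.of_forall fun x => tendsto_const_nhds.congr' ?_
  obtain ⟨N, hN⟩ := exists_nat_ge (g x)
  filter_upwards [eventually_ge_atTop N] with n hn
  have : (N : ℝ) ≤ n := by exact_mod_cast hn
  exact (min_eq_left (by linarith)).symm

end Limits

theorem normalizedDensity_rnDeriv {E : Type*} [MeasurableSpace E] {μ ν : Measure E}
    [SigmaFinite μ] [IsProbabilityMeasure ν] (hac : ν ≪ μ) :
    normalizedDensity μ (fun x => (ν.rnDeriv μ x).toReal) = ν := by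
  have hZ : ∫ x, (ν.rnDeriv μ x).toReal ∂μ = 1 := by
    rw [Measure.integral_toReal_rnDeriv hac]; simp
  rw [normalizedDensity, hZ]
  conv_rhs => rw [← Measure.withDensity_rnDeriv_eq ν μ hac]
  refine withDensity_congr_ae ?_
  filter_upwards [Measure.rnDeriv_lt_top ν μ] with x hx
  rw [div_one, ENNReal.ofReal_toReal hx.ne]

theorem weak_limit_satisfiesTp {E : Type*} [MetricSpace E] [CompleteSpace E]
    [TopologicalSpace.SeparableSpace E] [MeasurableSpace E] [BorelSpace E]
    (p C : ℝ) (hp : 1 ≤ p) (hC : 0 ≤ C)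
    (μseq : ℕ → Measure E) (μ : Measure E)
    (hseq : ∀ n, IsProbabilityMeasure (μseq n)) (hμ : IsProbabilityMeasure μ)
    (hTp : ∀ n, SatisfiesTp p C (μseq n))
    (hconv : ∀ f : E → ℝ, Continuous f → (∃ M, ∀ x, |f x| ≤ M) →
      Filter.Tendsto (fun n => ∫ x, f x ∂(μseq n)) Filter.atTop (nhds (∫ x, f x ∂μ))) :
    SatisfiesTp p C μ := by
  have : SecondCountableTopology E := UniformSpace.secondCountable_of_separable E
  have hp0 : 0 < p := by linarith
  let μs : ℕ → ProbabilityMeasure E := fun n => ⟨μseq n, hseq n⟩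
  let μ' : ProbabilityMeasure E := ⟨μ, hμ⟩
  have hlim : Tendsto μs atTop (𝓝 μ') := by
    rw [ProbabilityMeasure.tendsto_iff_forall_integral_tendsto]
    exact fun f => hconv f f.continuous ⟨‖f‖, fun x => f.norm_coe_le_norm x⟩
  intro ν hν
  by_cases hfin : ν ≪ μ ∧ Integrable (fun x => Real.log (ν.rnDeriv μ x).toReal) ν
  · obtain ⟨hac, hint⟩ := hfin
    have hmeas : Measurable fun x => (ν.rnDeriv μ x).toReal :=
      (Measure.measurable_rnDeriv ν μ).ennreal_toReal
    have h0 : ∀ x, 0 ≤ (ν.rnDeriv μ x).toReal := fun x => ENNReal.toReal_nonneg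
    have hi : Integrable (fun x => (ν.rnDeriv μ x).toReal) μ := Measure.integrable_toReal_rnDeriv
    have hl : Integrable (fun x => (ν.rnDeriv μ x).toReal * Real.log (ν.rnDeriv μ x).toReal) μ :=
      (integrable_rnDeriv_smul_iff hac).2 hint
    have hZ : 0 < ∫ x, (ν.rnDeriv μ x).toReal ∂μ := by
      rw [Measure.integral_toReal_rnDeriv hac]; simp
    have key : DensityTp p C μ (fun x => (ν.rnDeriv μ x).toReal) :=
      DensityTp.of_integrable hp0 (μ := μ')
        (fun g hg hg0 ⟨M, hgM⟩ hgZ => DensityTp.of_bounded hp0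
          (fun f hf hf0 ⟨K, hfK⟩ hfZ => DensityTp.of_continuous hp0 hlim hTp hf hf0 hfK hfZ)
          hg hg0 hgM hgZ) hmeas h0 hi hl hZ
    rwa [DensityTp, ← relEntropy_normalizedDensity hmeas h0 hi hl hZ,
      normalizedDensity_rnDeriv hac] at key
  · rw [relEntropy, if_neg hfin]
    rcases hC.eq_or_lt with rfl | hC
    · have h (n : ℕ) : wassersteinDist p (μseq n) ν ≤ 0 := by
        simpa using hTp n ν hν
      let ν' : ProbabilityMeasure E := ⟨ν, hν⟩
      exact (wassersteinDist_le_of_tendsto hp0 hlim (tendsto_const_nhds (x := ν'))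
        (tendsto_const_nhds (x := 0)) (Eventually.of_forall h)).trans bot_le
    · rw [ENNReal.mul_top (by simpa using hC), ENNReal.top_rpow_of_pos (by norm_num)]
      exact le_top
end

section
/- Let ν be a finite signed measure on ℝ such that |ν({a})| < 1 for every a ∈ ℝ, and let f_ν be the associated function. Then there exist constants m, M with 0 < m ≤ M such that m ≤ f_ν(x) ≤ M for all x ∈ ℝ (in particular the defining infinite product converges to a strictly positive value for every x). -/
open MeasureTheory
open scoped ENNReal NNReal

/-- The function `f_ν` associated to a finite signed measure `ν` on `ℝ`:
`f_ν(x) = exp(−2 ν^c((−∞,x])) ∏_{y atom of ν, y ≤ x} (1−ν({y}))/(1+ν({y}))`,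
where `ν^c(A) = ν(A \ D)` with `D` the set of atoms of `ν`. -/
noncomputable def fnu (ν : MeasureTheory.SignedMeasure ℝ) (x : ℝ) : ℝ :=
  Real.exp (-2 * ν (Set.Iic x \ {y : ℝ | ν {y} ≠ 0})) *
    ∏' y : {y : ℝ // ν {y} ≠ 0 ∧ y ≤ x}, (1 - ν {(y : ℝ)}) / (1 + ν {(y : ℝ)})

/-- The point masses of a finite signed measure are summable. -/
theorem MeasureTheory.SignedMeasure.summable_singleton {α : Type*} [MeasurableSpace α]
    [MeasurableSingletonClass α] (ν : SignedMeasure α) : Summable fun y => ν {y} := by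
  refine Summable.of_norm (summable_of_sum_le (c := ν.totalVariation.real Set.univ)
    (fun _ => norm_nonneg _) fun s => ?_)
  calc ∑ y ∈ s, ‖ν {y}‖ ≤ ∑ y ∈ s, ν.totalVariation.real {y} :=
        Finset.sum_le_sum fun y _ => ν.norm_le_totalVariation {y}
    _ = ν.totalVariation.real s := sum_measureReal_singleton s
    _ ≤ ν.totalVariation.real Set.univ := measureReal_mono (Set.subset_univ _)

theorem Real.one_sub_div_one_add_pos {t : ℝ} (ht : |t| < 1) : 0 < (1 - t) / (1 + t) := by
  obtain ⟨h₁, h₂⟩ := abs_lt.mp ht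
  exact div_pos (by linarith) (by linarith)

theorem Real.summable_log_one_sub_div_one_add {ι : Type*} {f : ι → ℝ} (hf : Summable f)
    (hf₁ : ∀ i, |f i| < 1) : Summable fun i => Real.log ((1 - f i) / (1 + f i)) := by
  refine ((Real.summable_log_one_add_of_summable hf.neg).sub
    (Real.summable_log_one_add_of_summable hf)).congr fun i => ?_
  obtain ⟨h₁, h₂⟩ := abs_lt.mp (hf₁ i)
  rw [Real.log_div (by linarith) (by linarith), sub_eq_add_neg 1 (f i)]

theorem fnu_bounded (ν : MeasureTheory.SignedMeasure ℝ) (hν : ∀ a : ℝ, |ν {a}| < 1) :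
    (∀ x : ℝ, Multipliable fun y : {y : ℝ // ν {y} ≠ 0 ∧ y ≤ x} =>
      (1 - ν {(y : ℝ)}) / (1 + ν {(y : ℝ)})) ∧
    (∀ x : ℝ, 0 < ∏' y : {y : ℝ // ν {y} ≠ 0 ∧ y ≤ x},
      (1 - ν {(y : ℝ)}) / (1 + ν {(y : ℝ)})) ∧
    ∃ m M : ℝ, 0 < m ∧ m ≤ M ∧ ∀ x : ℝ, m ≤ fnu ν x ∧ fnu ν x ≤ M := by
  have hpos (y : ℝ) := Real.one_sub_div_one_add_pos (hν y)
  have hlog := Real.summable_log_one_sub_div_one_add ν.summable_singleton hν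
  have hlog_sub (x : ℝ) : Summable fun y : {y : ℝ // ν {y} ≠ 0 ∧ y ≤ x} =>
      Real.log ((1 - ν {(y : ℝ)}) / (1 + ν {(y : ℝ)})) := hlog.subtype _
  have hexp (x : ℝ) := Real.rexp_tsum_eq_tprod
    (fun y : {y : ℝ // ν {y} ≠ 0 ∧ y ≤ x} => hpos y) (hlog_sub x)
  refine ⟨fun x => Real.multipliable_of_summable_log (fun y => hpos y) (hlog_sub x),
    fun x => hexp x ▸ Real.exp_pos _, ?_⟩
  set K := 2 * ν.totalVariation.real Set.univ +
    ∑' y, ‖Real.log ((1 - ν {y}) / (1 + ν {y}))‖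
  have hK₀ : 0 ≤ K := add_nonneg (mul_nonneg two_pos.le measureReal_nonneg)
    (tsum_nonneg fun _ => norm_nonneg _)
  refine ⟨Real.exp (-K), Real.exp K, Real.exp_pos _, Real.exp_le_exp.mpr (by linarith),
    fun x => ?_⟩
  have hcont : |ν (Set.Iic x \ {y : ℝ | ν {y} ≠ 0})| ≤ ν.totalVariation.real Set.univ :=
    (ν.norm_le_totalVariation _).trans (measureReal_mono (Set.subset_univ _))
  have hatoms : |∑' y : {y : ℝ // ν {y} ≠ 0 ∧ y ≤ x},
      Real.log ((1 - ν {(y : ℝ)}) / (1 + ν {(y : ℝ)}))| ≤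
      ∑' y, ‖Real.log ((1 - ν {y}) / (1 + ν {y}))‖ :=
    (norm_tsum_le_tsum_norm (hlog_sub x).norm).trans
      (hlog.norm.tsum_subtype_le _ {y : ℝ | ν {y} ≠ 0 ∧ y ≤ x} fun _ => norm_nonneg _)
  rw [fnu, ← hexp, ← Real.exp_add, Real.exp_le_exp, Real.exp_le_exp]
  rw [abs_le] at hcont hatoms
  constructor <;> linarith
end

section
/- Let ν be a finite signed measure on ℝ such that |ν({a})| < 1 for every a ∈ ℝ, and let f_ν be the associated function. Then f_ν has bounded variation on ℝ, i.e. the total variation of f_ν over ℝ (the supremum over all finite partitions x_0 < x_1 < … < x_n of ∑ |f_ν(x_i) − f_ν(x_{i−1})|) is finite. -/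
open MeasureTheory
open scoped ENNReal NNReal

/-- A function whose increments are dominated by those of a bounded function has bounded
variation. -/
theorem boundedVariationOn_of_abs_sub_le {f H : ℝ → ℝ} {C : ℝ}
    (hfH : ∀ x y, x ≤ y → |f y - f x| ≤ H y - H x) (hH : ∀ x, |H x| ≤ C) :
    BoundedVariationOn f Set.univ := by
  have hmono : MonotoneOn H Set.univ := fun x _ y _ hxy =>
    sub_nonneg.1 ((abs_nonneg _).trans (hfH x y hxy))
  refine ne_top_of_le_ne_top (hmono.boundedVariationOn (C := C) fun x _ => hH x) ?_
  refine iSup_mono fun p => Finset.sum_le_sum fun i _ => ?_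
  rw [edist_dist, edist_dist, Real.dist_eq, Real.dist_eq]
  exact ENNReal.ofReal_le_ofReal
    ((hfH _ _ (p.2.2.1 (Nat.le_succ i))).trans (le_abs_self _))

/-- The exponential of a real function of bounded variation has bounded variation. -/
theorem BoundedVariationOn.exp_univ {g : ℝ → ℝ} (hg : BoundedVariationOn g Set.univ) :
    BoundedVariationOn (fun x => Real.exp (g x)) Set.univ := by
  set M : ℝ := g 0 + (eVariationOn g Set.univ).toReal
  have hM : Set.MapsTo g Set.univ (Set.Iic M) := fun x _ => by
    have := hg.sub_le (Set.mem_univ x) (Set.mem_univ 0)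
    simp only [Set.mem_Iic, M]
    linarith
  have hexp : LipschitzOnWith (Real.exp M).toNNReal Real.exp (Set.Iic M) := by
    refine (convex_Iic M).lipschitzOnWith_of_nnnorm_deriv_le
      (fun x _ => Real.differentiableAt_exp) fun x hx => ?_
    rw [Real.deriv_exp, ← NNReal.coe_le_coe, coe_nnnorm, Real.norm_eq_abs, Real.abs_exp,
      Real.coe_toNNReal _ (Real.exp_pos M).le]
    exact Real.exp_le_exp.2 hx
  exact hexp.comp_boundedVariationOn hM hg

namespace MeasureTheory.SignedMeasure

theorem abs_apply_le_totalVariation_real {α : Type*} [MeasurableSpace α] (ν : SignedMeasure α)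
    {s : Set α} (hs : MeasurableSet s) : |ν s| ≤ ν.totalVariation.real s := by
  rw [ν.apply_eq_posPart_real_sub_negPart_real hs, totalVariation, measureReal_add_apply]
  refine (abs_sub _ _).trans_eq ?_
  rw [abs_of_nonneg measureReal_nonneg, abs_of_nonneg measureReal_nonneg]

theorem summable_abs_apply_singleton {α : Type*} [MeasurableSpace α] [MeasurableSingletonClass α]
    (ν : SignedMeasure α) : Summable fun a => |ν {a}| := by
  refine summable_of_sum_le (c := ν.totalVariation.real Set.univ) (fun _ => abs_nonneg _)
    fun u => ?_
  calc ∑ a ∈ u, |ν {a}| ≤ ∑ a ∈ u, ν.totalVariation.real {a} :=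
        Finset.sum_le_sum fun a _ =>
          ν.abs_apply_le_totalVariation_real (measurableSet_singleton a)
    _ = ν.totalVariation.real u := sum_measureReal_singleton u
    _ ≤ ν.totalVariation.real Set.univ := measureReal_mono (Set.subset_univ _)

theorem countable_setOf_apply_singleton_ne_zero {α : Type*} [MeasurableSpace α]
    [MeasurableSingletonClass α] (ν : SignedMeasure α) : {a | ν {a} ≠ 0}.Countable := by
  simpa [Function.support] using ν.summable_abs_apply_singleton.countable_support

/-- The increments of the distribution function of `ν` off a measurable set are dominated by those
of the distribution function of its total variation. -/
theorem abs_apply_Iic_diff_sub_le (ν : SignedMeasure ℝ) {D : Set ℝ} (hD : MeasurableSet D)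
    {x y : ℝ} (hxy : x ≤ y) :
    |ν (Set.Iic y \ D) - ν (Set.Iic x \ D)| ≤
      ν.totalVariation.real (Set.Iic y) - ν.totalVariation.real (Set.Iic x) := by
  have hsub : Set.Iic x ⊆ Set.Iic y := Set.Iic_subset_Iic.2 hxy
  have h := VectorMeasure.of_add_of_sdiff (v := ν) (measurableSet_Iic.diff hD)
    (measurableSet_Iic.diff hD) (Set.sdiff_subset_sdiff_left (t := D) hsub)
  rw [← measureReal_sdiff hsub measurableSet_Iic, ← h, add_sub_cancel_left]
  refine (ν.abs_apply_le_totalVariation_real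
    ((measurableSet_Iic.diff hD).diff (measurableSet_Iic.diff hD))).trans (measureReal_mono ?_)
  rintro z ⟨⟨hzy, hzD⟩, hz⟩
  exact ⟨hzy, fun hzx => hz ⟨hzx, hzD⟩⟩

end MeasureTheory.SignedMeasure

/-- The increments of the partial sums of a summable family indexed by `ℝ` are dominated by those
of the partial sums of its absolute value. -/
theorem abs_tsum_indicator_Iic_sub_le {L : ℝ → ℝ} (hL : Summable L) {x y : ℝ} (hxy : x ≤ y) :
    |∑' z, (Set.Iic y).indicator L z - ∑' z, (Set.Iic x).indicator L z| ≤
      ∑' z, (Set.Iic y).indicator (fun z => |L z|) z -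
        ∑' z, (Set.Iic x).indicator (fun z => |L z|) z := by
  rw [← (hL.indicator _).tsum_sub (hL.indicator _),
    ← (hL.abs.indicator _).tsum_sub (hL.abs.indicator _), ← Real.norm_eq_abs]
  refine tsum_of_norm_bounded ((hL.abs.indicator _).sub (hL.abs.indicator _)).hasSum fun z => ?_
  by_cases hzx : z ≤ x
  · simp [hzx, hzx.trans hxy]
  · by_cases hzy : z ≤ y <;> simp [hzx, hzy]

/-- The logarithm of the jump factor of `fnu ν` at `y`. -/
noncomputable def logJump (ν : SignedMeasure ℝ) (y : ℝ) : ℝ :=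
  Real.log ((1 - ν {y}) / (1 + ν {y}))

theorem summable_logJump {ν : SignedMeasure ℝ} (hν : ∀ a : ℝ, |ν {a}| < 1) :
    Summable (logJump ν) := by
  have hs : Summable fun a => ν {a} := ν.summable_abs_apply_singleton.of_abs
  refine ((Real.summable_log_one_add_of_summable hs.neg).sub
    (Real.summable_log_one_add_of_summable hs)).congr fun a => ?_
  obtain ⟨h₁, h₂⟩ := abs_lt.1 (hν a)
  rw [logJump, Real.log_div (by linarith) (by linarith), sub_eq_add_neg 1 (ν {a})]

theorem fnu_eq_exp {ν : SignedMeasure ℝ} (hν : ∀ a : ℝ, |ν {a}| < 1) (x : ℝ) :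
    fnu ν x = Real.exp (-2 * ν (Set.Iic x \ {y : ℝ | ν {y} ≠ 0}) +
      ∑' y, (Set.Iic x).indicator (logJump ν) y) := by
  have htsum : ∑' y, (Set.Iic x).indicator (logJump ν) y =
      ∑' y : {y : ℝ // ν {y} ≠ 0 ∧ y ≤ x}, logJump ν y := by
    refine (tsum_congr fun y => ?_).trans
      (tsum_subtype {y : ℝ | ν {y} ≠ 0 ∧ y ≤ x} (logJump ν)).symm
    by_cases hy : ν {y} = 0 <;> by_cases hyx : y ≤ x <;> simp [hy, hyx, logJump]
  rw [fnu, Real.exp_add, htsum]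
  congr 1
  refine (Real.rexp_tsum_eq_tprod (fun y => ?_) ((summable_logJump hν).subtype _)).symm
  obtain ⟨h₁, h₂⟩ := abs_lt.1 (hν y)
  exact div_pos (by linarith) (by linarith)

theorem fnu_boundedVariation (ν : MeasureTheory.SignedMeasure ℝ)
    (hν : ∀ a : ℝ, |ν {a}| < 1) :
    BoundedVariationOn (fnu ν) Set.univ := by
  have hD := ν.countable_setOf_apply_singleton_ne_zero.measurableSet
  have hL := summable_logJump hν
  rw [funext (fnu_eq_exp hν)]
  refine BoundedVariationOn.exp_univ (boundedVariationOn_of_abs_sub_le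
    (H := fun x => 2 * ν.totalVariation.real (Set.Iic x) +
      ∑' z, (Set.Iic x).indicator (fun z => |logJump ν z|) z)
    (C := 2 * ν.totalVariation.real Set.univ + ∑' z, |logJump ν z|) ?_ ?_)
  · intro x y hxy
    have h₁ := abs_le.1 (ν.abs_apply_Iic_diff_sub_le hD hxy)
    have h₂ := abs_le.1 (abs_tsum_indicator_Iic_sub_le hL hxy)
    rw [abs_le]
    constructor <;> linarith
  · intro x
    have hle : ∑' z, (Set.Iic x).indicator (fun z => |logJump ν z|) z ≤ ∑' z, |logJump ν z| :=
      (hL.abs.indicator _).tsum_le_tsum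
        (Set.indicator_le_self' fun z _ => abs_nonneg _) hL.abs
    have hnonneg : 0 ≤ ∑' z, (Set.Iic x).indicator (fun z => |logJump ν z|) z :=
      tsum_nonneg fun z => Set.indicator_nonneg (fun z _ => abs_nonneg _) z
    rw [abs_of_nonneg (by positivity)]
    exact add_le_add (mul_le_mul_of_nonneg_left (measureReal_mono (Set.subset_univ _)) two_pos.le)
      hle
end

section
/- Let (E,d) be a metric space with its Borel σ-algebra and let μ be a Borel probability measure on E satisfying T_1(C) for some C > 0. Then for every Lipschitz function F : E → ℝ with Lipschitz constant ‖F‖_Lip > 0 that is integrable with respect to μ, and for every r > 0, μ({x : F(x) − ∫ F dμ > r}) ≤ exp(−r²/(2C·‖F‖²_Lip)). -/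
open MeasureTheory
open scoped ENNReal NNReal

/-- The easy half of Kantorovich–Rubinstein duality: the means of a Lipschitz function under two
measures differ by at most its Lipschitz constant times the Wasserstein distance of order one. -/
theorem enorm_integral_sub_le_mul_wassersteinDist_one {E : Type*} [PseudoEMetricSpace E]
    [MeasurableSpace E] {μ ν : Measure E} {K : ℝ≥0} {F : E → ℝ} (hF : LipschitzWith K F)
    (hK : K ≠ 0) (hμ : Integrable F μ) (hν : Integrable F ν) :
    ‖∫ y, F y ∂ν - ∫ x, F x ∂μ‖ₑ ≤ K * wassersteinDist 1 μ ν := by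
  rw [wassersteinDist, ENNReal.mul_iInf_of_ne (by simpa) ENNReal.coe_ne_top]
  refine le_iInf fun π => ?_
  rw [ENNReal.mul_iInf_of_ne (by simpa) ENNReal.coe_ne_top]
  refine le_iInf fun ⟨hfst, hsnd⟩ => ?_
  subst hfst hsnd
  rw [integral_map measurable_snd.aemeasurable hν.aestronglyMeasurable,
    integral_map measurable_fst.aemeasurable hμ.aestronglyMeasurable,
    ← integral_sub (f := fun z : E × E => F z.2) (g := fun z : E × E => F z.1)
      (hν.comp_measurable measurable_snd) (hμ.comp_measurable measurable_fst)]
  simp only [ENNReal.rpow_one, div_one]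
  rw [← lintegral_const_mul' _ _ ENNReal.coe_ne_top]
  refine (enorm_integral_le_lintegral_enorm _).trans (lintegral_mono fun z => ?_)
  rw [← edist_eq_enorm_sub, edist_comm]
  exact hF z.1 z.2

/-- The relative entropy of a conditioned measure. -/
theorem relEntropy_cond_self {E : Type*} [MeasurableSpace E] (μ : Measure E)
    [IsProbabilityMeasure μ] {A : Set E} (hA : MeasurableSet A) (h0 : μ A ≠ 0) :
    relEntropy (ProbabilityTheory.cond μ A) μ = ENNReal.ofReal (-Real.log (μ.real A)) := by
  have := ProbabilityTheory.cond_isProbabilityMeasure h0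
  have hlog : (fun x => Real.log ((ProbabilityTheory.cond μ A).rnDeriv μ x).toReal)
      =ᵐ[ProbabilityTheory.cond μ A] fun _ => -Real.log (μ.real A) := by
    have hd : ProbabilityTheory.cond μ A = μ.withDensity (A.indicator fun _ => (μ A)⁻¹) := by
      rw [withDensity_indicator hA, withDensity_const, ProbabilityTheory.cond]
    have hr : (ProbabilityTheory.cond μ A).rnDeriv μ =ᵐ[μ] A.indicator fun _ => (μ A)⁻¹ := by
      rw [hd]
      exact Measure.rnDeriv_withDensity μ (measurable_const.indicator hA)
    filter_upwards [ProbabilityTheory.cond_absolutelyContinuous.ae_le hr,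
      ProbabilityTheory.ae_cond_mem hA] with x hx hxA
    rw [hx, Set.indicator_of_mem hxA, ENNReal.toReal_inv, Real.log_inv, measureReal_def]
  rw [relEntropy, if_pos ⟨ProbabilityTheory.cond_absolutelyContinuous,
    (integrable_congr hlog).2 (integrable_const _)⟩, integral_congr_ae hlog]
  simp

theorem T1_concentration_lipschitz {E : Type*}
    [MetricSpace E] [MeasurableSpace E] [BorelSpace E]
    (μ : Measure E) [IsProbabilityMeasure μ] (C : ℝ) (hC : 0 < C)
    (hT : SatisfiesTp 1 C μ)
    (F : E → ℝ) (L : ℝ) (hL : 0 < L) (hF : LipschitzWith L.toNNReal F)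
    (hInt : Integrable F μ) :
    ∀ r : ℝ, 0 < r →
      μ {x | F x - ∫ y, F y ∂μ > r} ≤
        ENNReal.ofReal (Real.exp (-(r ^ 2) / (2 * C * L ^ 2))) := by
  intro r hr
  set A := {x | F x - ∫ y, F y ∂μ > r}
  have hA : MeasurableSet A :=
    measurableSet_lt measurable_const (hF.continuous.measurable.sub_const _)
  obtain h0 | h0 := eq_or_ne (μ A) 0
  · simp [h0]
  have hprob := ProbabilityTheory.cond_isProbabilityMeasure h0
  have hIntA : Integrable F (ProbabilityTheory.cond μ A) :=
    hInt.restrict.smul_measure (ENNReal.inv_ne_top.2 h0)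
  have hmean : r ≤ ∫ y, F y ∂(ProbabilityTheory.cond μ A) - ∫ y, F y ∂μ := by
    have h : ∫ _, r + ∫ y, F y ∂μ ∂(ProbabilityTheory.cond μ A)
        ≤ ∫ y, F y ∂(ProbabilityTheory.cond μ A) := by
      refine integral_mono_ae (integrable_const _) hIntA ?_
      filter_upwards [ProbabilityTheory.ae_cond_mem hA] with x hx
      have : F x - ∫ y, F y ∂μ > r := hx
      linarith
    rw [integral_const, probReal_univ, one_smul] at h
    linarith
  have hpos : 0 < μ.real A := ENNReal.toReal_pos h0 (measure_ne_top _ _)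
  have hlog : 0 ≤ -Real.log (μ.real A) :=
    neg_nonneg.2 (Real.log_nonpos hpos.le measureReal_le_one)
  have hsqrt : r ≤ L * Real.sqrt (2 * C * -Real.log (μ.real A)) := by
    have h := (enorm_integral_sub_le_mul_wassersteinDist_one hF
      (Real.toNNReal_pos.2 hL).ne' hInt hIntA).trans (mul_le_mul_right (hT _ hprob) _)
    rw [relEntropy_cond_self μ hA h0, ← ENNReal.ofReal_mul (by positivity),
      ENNReal.ofReal_rpow_of_nonneg (by positivity) (by positivity), ← Real.sqrt_eq_rpow,
      ← ENNReal.ofReal, ← ENNReal.ofReal_mul hL.le,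
      Real.enorm_eq_ofReal (hr.le.trans hmean), ENNReal.ofReal_le_ofReal_iff (by positivity)] at h
    exact hmean.trans h
  have hsq : r ^ 2 ≤ L ^ 2 * (2 * C * -Real.log (μ.real A)) := by
    calc r ^ 2 ≤ (L * Real.sqrt (2 * C * -Real.log (μ.real A))) ^ 2 := by gcongr
      _ = _ := by rw [mul_pow, Real.sq_sqrt (by positivity)]
  rw [← ofReal_measureReal]
  refine ENNReal.ofReal_le_ofReal ((Real.log_le_iff_le_exp hpos).1 ?_)
  rw [le_div_iff₀ (by positivity)]
  linarith
end

section
/- Let (E,d) be a metric space with its Borel σ-algebra and let μ be a Borel probability measure on E satisfying T_1(C) for some C > 0. Then for every Borel set A with μ(A) ≥ 1/2 and every r ≥ r₀ := √(2C·log 2), the closed r-enlargement A^r = {x ∈ E : d(x,A) ≤ r} satisfies μ(A^r) ≥ 1 − exp(−(r − r₀)²/(2C)). -/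
open MeasureTheory
open scoped ENNReal NNReal

theorem lintegral_le_lintegral_add_wassersteinDist {E : Type*} [PseudoEMetricSpace E]
    [MeasurableSpace E] {f : E → ℝ≥0∞} (hf : Measurable f)
    (hlip : ∀ x y, f y ≤ f x + edist x y) (μ ν : Measure E) :
    ∫⁻ x, f x ∂ν ≤ ∫⁻ x, f x ∂μ + wassersteinDist 1 μ ν := by
  unfold wassersteinDist
  simp only [ENNReal.add_iInf, ENNReal.rpow_one, div_one]
  refine le_iInf₂ fun π hπ => ?_
  obtain ⟨rfl, rfl⟩ := hπ
  rw [lintegral_map hf measurable_fst, lintegral_map hf measurable_snd,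
    ← lintegral_add_left (by fun_prop)]
  exact lintegral_mono fun z => hlip z.1 z.2

theorem lintegral_le_lintegral_add_wassersteinDist' {E : Type*} [PseudoEMetricSpace E]
    [MeasurableSpace E] {f : E → ℝ≥0∞} (hf : Measurable f)
    (hlip : ∀ x y, f y ≤ f x + edist x y) (μ ν : Measure E) :
    ∫⁻ x, f x ∂μ ≤ ∫⁻ x, f x ∂ν + wassersteinDist 1 μ ν := by
  unfold wassersteinDist
  simp only [ENNReal.add_iInf, ENNReal.rpow_one, div_one]
  refine le_iInf₂ fun π hπ => ?_
  obtain ⟨rfl, rfl⟩ := hπ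
  rw [lintegral_map hf measurable_fst, lintegral_map hf measurable_snd,
    ← lintegral_add_left (by fun_prop)]
  exact lintegral_mono fun z => by simpa only [edist_comm] using hlip z.2 z.1

theorem relEntropy_cond {E : Type*} [MeasurableSpace E] (μ : Measure E) [IsProbabilityMeasure μ]
    {S : Set E} (hS : MeasurableSet S) (h0 : μ S ≠ 0) :
    relEntropy (ProbabilityTheory.cond μ S) μ = ENNReal.ofReal (-Real.log (μ.real S)) := by
  have := ProbabilityTheory.cond_isProbabilityMeasure h0
  have hac : ProbabilityTheory.cond μ S ≪ μ := ProbabilityTheory.cond_absolutelyContinuous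
  have hd : ProbabilityTheory.cond μ S = μ.withDensity (S.indicator fun _ => (μ S)⁻¹) := by
    rw [withDensity_indicator hS, withDensity_const, ProbabilityTheory.cond]
  have hrn : (ProbabilityTheory.cond μ S).rnDeriv μ =ᵐ[μ] S.indicator fun _ => (μ S)⁻¹ := by
    rw [hd]
    exact Measure.rnDeriv_withDensity _ (measurable_const.indicator hS)
  have hlog : (fun x => Real.log ((ProbabilityTheory.cond μ S).rnDeriv μ x).toReal)
      =ᵐ[ProbabilityTheory.cond μ S] fun _ => -Real.log (μ.real S) := by
    filter_upwards [hac.ae_le hrn, ProbabilityTheory.ae_cond_mem hS] with x hx hxS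
    rw [hx, Set.indicator_of_mem hxS, ENNReal.toReal_inv, Real.log_inv, Measure.real]
  rw [relEntropy, if_pos ⟨hac, (integrable_const _).congr hlog.symm⟩, integral_congr_ae hlog]
  simp

theorem SatisfiesTp.wassersteinDist_cond_le {E : Type*} [PseudoEMetricSpace E]
    [MeasurableSpace E] {p C : ℝ} {μ : Measure E} [IsProbabilityMeasure μ] (hC : 0 ≤ C)
    (hT : SatisfiesTp p C μ) {S : Set E} (hS : MeasurableSet S) (h0 : μ S ≠ 0) :
    wassersteinDist p μ (ProbabilityTheory.cond μ S)
      ≤ ENNReal.ofReal (Real.sqrt (2 * C * -Real.log (μ.real S))) := by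
  refine (hT _ (ProbabilityTheory.cond_isProbabilityMeasure h0)).trans_eq ?_
  have hlog : 0 ≤ -Real.log (μ.real S) :=
    neg_nonneg.2 (Real.log_nonpos measureReal_nonneg measureReal_le_one)
  rw [relEntropy_cond μ hS h0, ← ENNReal.ofReal_mul (by positivity),
    ENNReal.ofReal_rpow_of_nonneg (by positivity) (by norm_num), Real.sqrt_eq_rpow]

theorem T1_enlargement_concentration {E : Type*}
    [MetricSpace E] [MeasurableSpace E] [BorelSpace E]
    (μ : Measure E) [IsProbabilityMeasure μ] (C : ℝ) (hC : 0 < C)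
    (hT : SatisfiesTp 1 C μ)
    (A : Set E) (hA : MeasurableSet A) (hμA : (1 : ℝ≥0∞) / 2 ≤ μ A)
    (r : ℝ) (hr : Real.sqrt (2 * C * Real.log 2) ≤ r) :
    1 - ENNReal.ofReal (Real.exp (-(r - Real.sqrt (2 * C * Real.log 2)) ^ 2 / (2 * C)))
      ≤ μ {x | Metric.infDist x A ≤ r} := by
  have hA0 : μ A ≠ 0 := (lt_of_lt_of_le (by simp) hμA).ne'
  have hAne : A.Nonempty := nonempty_of_measure_ne_zero hA0
  have hAr : (1 : ℝ) / 2 ≤ μ.real A := by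
    simpa [Measure.real] using ENNReal.toReal_mono (measure_ne_top μ A) hμA
  have hr0 : 0 ≤ r := (Real.sqrt_nonneg _).trans hr
  set B : Set E := {x | Metric.infDist x A ≤ r}ᶜ with hB
  have hD : MeasurableSet {x | Metric.infDist x A ≤ r} :=
    measurableSet_le measurable_infDist measurable_const
  rw [tsub_le_iff_right, ← prob_add_prob_compl (μ := μ) hD]
  gcongr
  by_cases hB0 : μ B = 0
  · rw [← hB, hB0]; exact zero_le
  have hBpos : 0 < μ.real B := ENNReal.toReal_pos hB0 (measure_ne_top _ _)
  rw [← hB, ← ofReal_measureReal]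
  refine ENNReal.ofReal_le_ofReal ?_
  rw [← Real.log_le_iff_le_exp hBpos]
  have hf : Measurable fun x => Metric.infEDist x A := measurable_infEDist
  have hlip : ∀ x y, Metric.infEDist y A ≤ Metric.infEDist x A + edist x y := fun x y => by
    rw [edist_comm]; exact Metric.infEDist_le_infEDist_add_edist
  have hνA : ∫⁻ x, Metric.infEDist x A ∂(ProbabilityTheory.cond μ A) = 0 := by
    rw [lintegral_eq_zero_iff hf]
    filter_upwards [ProbabilityTheory.ae_cond_mem hA] with x hx
    exact Metric.infEDist_zero_of_mem hx
  have hνB : ENNReal.ofReal r ≤ ∫⁻ x, Metric.infEDist x A ∂(ProbabilityTheory.cond μ B) := by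
    have := ProbabilityTheory.cond_isProbabilityMeasure hB0
    calc ENNReal.ofReal r = ∫⁻ _, ENNReal.ofReal r ∂(ProbabilityTheory.cond μ B) := by simp
      _ ≤ _ := by
        refine lintegral_mono_ae ?_
        filter_upwards [ProbabilityTheory.ae_cond_mem hD.compl] with x hx
        rw [ENNReal.ofReal_le_iff_le_toReal (Metric.infEDist_ne_top hAne)]
        exact le_of_not_ge hx
  have key : ENNReal.ofReal r ≤ ENNReal.ofReal (Real.sqrt (2 * C * Real.log 2)
      + Real.sqrt (2 * C * -Real.log (μ.real B))) := by
    rw [ENNReal.ofReal_add (Real.sqrt_nonneg _) (Real.sqrt_nonneg _)]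
    refine hνB.trans ((lintegral_le_lintegral_add_wassersteinDist hf hlip μ _).trans ?_)
    refine add_le_add ?_ (hT.wassersteinDist_cond_le hC.le hD.compl hB0)
    refine (lintegral_le_lintegral_add_wassersteinDist' hf hlip μ
      (ProbabilityTheory.cond μ A)).trans ?_
    rw [hνA, zero_add]
    refine (hT.wassersteinDist_cond_le hC.le hA hA0).trans ?_
    have hlog : -Real.log (μ.real A) ≤ Real.log 2 := by
      have := Real.log_le_log (by norm_num) hAr
      rw [one_div, Real.log_inv] at this
      linarith
    gcongr
  rw [ENNReal.ofReal_le_ofReal_iff (by positivity)] at key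
  have hlogB : 0 ≤ 2 * C * -Real.log (μ.real B) :=
    mul_nonneg (by positivity) (neg_nonneg.2 (Real.log_nonpos hBpos.le measureReal_le_one))
  have hsq : (r - Real.sqrt (2 * C * Real.log 2)) ^ 2 ≤ 2 * C * -Real.log (μ.real B) := by
    rw [← Real.sq_sqrt hlogB]
    exact pow_le_pow_left₀ (sub_nonneg.2 hr) (by linarith) 2
  rw [le_div_iff₀ (by positivity)]
  linarith
end

section
/- Let (E,d) be a complete separable metric space with its Borel σ-algebra and let μ be a Borel probability measure on E satisfying T_2(C) for some C > 0. Then for every bounded Borel measurable function F : E → ℝ, the inf-convolution Q_C F(x) := inf_{y∈E} ( F(y) + d(x,y)²/(2C) ) satisfies ∫ exp(Q_C F) dμ ≤ exp( ∫ F dμ ). -/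
open MeasureTheory
open scoped ENNReal NNReal

open InformationTheory

/-- Nonnegativity of `f` is not needed for this half of `ofReal_integral_eq_lintegral_ofReal`. -/
lemma ofReal_integral_le_lintegral_ofReal {α : Type*} [MeasurableSpace α] {μ : Measure α}
    {f : α → ℝ} (hf : Integrable f μ) :
    ENNReal.ofReal (∫ x, f x ∂μ) ≤ ∫⁻ x, ENNReal.ofReal (f x) ∂μ := by
  calc ENNReal.ofReal (∫ x, f x ∂μ)
      ≤ ENNReal.ofReal (∫ x, max (f x) 0 ∂μ) :=
        ENNReal.ofReal_le_ofReal (integral_mono hf hf.pos_part fun x => le_max_left _ _)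
    _ = ∫⁻ x, ENNReal.ofReal (max (f x) 0) ∂μ :=
        ofReal_integral_eq_lintegral_ofReal hf.pos_part (ae_of_all _ fun x => le_max_right _ _)
    _ = ∫⁻ x, ENNReal.ofReal (f x) ∂μ := by simp [ENNReal.ofReal_max]

/-- Weak Kantorovich duality for the quadratic cost. -/
lemma ofReal_integral_sub_integral_rpow_le_wassersteinDist {E : Type*} [PseudoMetricSpace E]
    [MeasurableSpace E] {μ ν : Measure E} {f g : E → ℝ} (hf : Integrable f ν)
    (hg : Integrable g μ) (hfg : ∀ x y, f y - g x ≤ dist x y ^ 2) :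
    ENNReal.ofReal (∫ y, f y ∂ν - ∫ x, g x ∂μ) ^ (1 / 2 : ℝ) ≤ wassersteinDist 2 μ ν := by
  refine le_iInf₂ fun π hπ => ?_
  obtain ⟨rfl, rfl⟩ := hπ
  refine ENNReal.rpow_le_rpow ?_ (by norm_num)
  have hf' : Integrable (fun z : E × E => f z.2) π := hf.comp_measurable measurable_snd
  have hg' : Integrable (fun z : E × E => g z.1) π := hg.comp_measurable measurable_fst
  rw [integral_map measurable_snd.aemeasurable hf.aestronglyMeasurable,
    integral_map measurable_fst.aemeasurable hg.aestronglyMeasurable, ← integral_sub hf' hg']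
  refine (ofReal_integral_le_lintegral_ofReal (hf'.sub hg')).trans (lintegral_mono fun z => ?_)
  rw [ENNReal.rpow_two, edist_dist, ← ENNReal.ofReal_pow dist_nonneg]
  exact ENNReal.ofReal_le_ofReal (hfg z.1 z.2)

/-- The relative entropy of an exponential tilt, when the tilting function is integrable. -/
lemma relEntropy_tilted {E : Type*} [MeasurableSpace E] {μ : Measure E} [IsProbabilityMeasure μ]
    {f : E → ℝ} (hexp : Integrable (fun x => Real.exp (f x)) μ)
    (hf : Integrable f (μ.tilted f)) :
    0 ≤ ∫ x, f x ∂μ.tilted f - Real.log (∫ x, Real.exp (f x) ∂μ) ∧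
    relEntropy (μ.tilted f) μ =
      ENNReal.ofReal (∫ x, f x ∂μ.tilted f - Real.log (∫ x, Real.exp (f x) ∂μ)) := by
  have : IsProbabilityMeasure (μ.tilted f) := isProbabilityMeasure_tilted hexp
  have hac := tilted_absolutelyContinuous μ f
  have hlog := hac.ae_eq (log_rnDeriv_tilted_left_self hexp)
  have hint : Integrable (fun x => Real.log ((μ.tilted f).rnDeriv μ x).toReal) (μ.tilted f) :=
    (hf.sub (integrable_const _)).congr hlog.symm
  have heq : ∫ x, Real.log ((μ.tilted f).rnDeriv μ x).toReal ∂μ.tilted f =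
      ∫ x, f x ∂μ.tilted f - Real.log (∫ x, Real.exp (f x) ∂μ) := by
    rw [integral_congr_ae hlog, integral_sub hf (integrable_const _)]
    simp
  refine ⟨?_, ?_⟩
  · have h := integral_llr_add_sub_measure_univ_nonneg hac hint
    simp only [probReal_univ, add_sub_cancel_right] at h
    exact heq ▸ h
  · rw [relEntropy, if_pos ⟨hac, hint⟩, heq]

/-- The quadratic inf-convolution of any function bounded below is measurable. -/
lemma measurable_iInf_add_dist_sq {E : Type*} [PseudoMetricSpace E] [MeasurableSpace E]
    [OpensMeasurableSpace E] {F : E → ℝ} {C : ℝ}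
    (hbdd : ∀ x, BddBelow (Set.range fun y => F y + dist x y ^ 2 / (2 * C))) :
    Measurable fun x => ⨅ y : E, (F y + dist x y ^ 2 / (2 * C)) :=
  (upperSemicontinuous_ciInf hbdd fun y =>
    Continuous.upperSemicontinuous (by fun_prop)).measurable

theorem T2_infConvolution_exp_ineq {E : Type*} [MetricSpace E] [CompleteSpace E]
    [TopologicalSpace.SeparableSpace E] [MeasurableSpace E] [BorelSpace E]
    (μ : Measure E) [IsProbabilityMeasure μ] (C : ℝ) (hC : 0 < C)
    (hT : SatisfiesTp 2 C μ)
    (F : E → ℝ) (hmeas : Measurable F) (hbdd : ∃ M, ∀ x, |F x| ≤ M) :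
    ∫ x, Real.exp (⨅ y : E, (F y + dist x y ^ 2 / (2 * C))) ∂μ
      ≤ Real.exp (∫ x, F x ∂μ) := by
  obtain ⟨M, hM⟩ := hbdd
  have : Nonempty E := nonempty_of_isProbabilityMeasure μ
  set Q : E → ℝ := fun x => ⨅ y : E, (F y + dist x y ^ 2 / (2 * C)) with hQ
  have hlow : ∀ x y, -M ≤ F y + dist x y ^ 2 / (2 * C) := fun x y => by
    have : 0 ≤ dist x y ^ 2 / (2 * C) := by positivity
    linarith [(abs_le.1 (hM y)).1]
  have hbelow : ∀ x, BddBelow (Set.range fun y => F y + dist x y ^ 2 / (2 * C)) := fun x =>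
    ⟨-M, Set.forall_mem_range.2 (hlow x)⟩
  have hQle : ∀ x y, Q x ≤ F y + dist x y ^ 2 / (2 * C) := fun x y => ciInf_le (hbelow x) y
  have hQbdd : ∀ x, |Q x| ≤ M := fun x => abs_le.2
    ⟨le_ciInf (hlow x), (hQle x x).trans (by simpa using (abs_le.1 (hM x)).2)⟩
  have hQmeas : Measurable Q := measurable_iInf_add_dist_sq hbelow
  have hexp : Integrable (fun x => Real.exp (Q x)) μ :=
    .of_bound hQmeas.exp.aestronglyMeasurable (Real.exp M) (ae_of_all _ fun x => by
      simpa using (abs_le.1 (hQbdd x)).2)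
  have hν : IsProbabilityMeasure (μ.tilted Q) := isProbabilityMeasure_tilted hexp
  have hQint : Integrable Q (μ.tilted Q) :=
    .of_bound hQmeas.aestronglyMeasurable M (ae_of_all _ hQbdd)
  have hFint : Integrable F μ := .of_bound hmeas.aestronglyMeasurable M (ae_of_all _ hM)
  obtain ⟨hnonneg, hent⟩ := relEntropy_tilted hexp hQint
  have hdual := ofReal_integral_sub_integral_rpow_le_wassersteinDist
    (hQint.const_mul (2 * C)) (hFint.const_mul (2 * C)) fun x y => by
      have h := hQle y x
      rw [dist_comm, ← sub_le_iff_le_add', le_div_iff₀ (by positivity)] at h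
      linarith
  have hle := hdual.trans (hT _ hν)
  rw [hent, ENNReal.rpow_le_rpow_iff (by norm_num), ← ENNReal.ofReal_mul (by positivity),
    ENNReal.ofReal_le_ofReal_iff (by positivity), integral_const_mul, integral_const_mul,
    ← mul_sub, mul_le_mul_iff_right₀ (by positivity)] at hle
  rw [← Real.log_le_iff_le_exp (integral_exp_pos hexp)]
  linarith
end

section
/- Let μ be a Borel probability measure on ℝ^d (with the Euclidean metric) satisfying T_2(C) for some C > 0. Then for every smooth compactly supported function g : ℝ^d → ℝ, the Poincaré inequality Var_μ(g) ≤ C·∫ ‖∇g‖² dμ holds, where Var_μ(g) = ∫ g² dμ − (∫ g dμ)². -/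
open MeasureTheory
open scoped ENNReal NNReal

theorem one_add_mul_log_one_add_le {u : ℝ} (hu : |u| ≤ 1 / 2) :
    (1 + u) * Real.log (1 + u) ≤ u + u ^ 2 / 2 + 4 * |u| ^ 3 := by
  have h := Real.abs_log_sub_add_sum_range_le (x := -u) (by rw [abs_neg]; linarith) 2
  simp only [Finset.sum_range_succ, Finset.sum_range_zero, abs_neg, sub_neg_eq_add] at h
  norm_num at h
  have hdiv : |u| ^ 3 / (1 - |u|) ≤ 2 * |u| ^ 3 := by
    rw [div_le_iff₀ (by linarith)]
    nlinarith [pow_nonneg (abs_nonneg u) 3]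
  have hlog : Real.log (1 + u) ≤ u - u ^ 2 / 2 + 2 * |u| ^ 3 := by
    linarith [(abs_le.1 h).2]
  obtain ⟨h₁, h₂⟩ := abs_le.1 hu
  have hcube : -u ^ 3 ≤ |u| ^ 3 := by
    rw [← abs_pow]; exact neg_le_abs _
  have hpos : 0 ≤ |u| ^ 3 := by positivity
  calc (1 + u) * Real.log (1 + u)
      ≤ (1 + u) * (u - u ^ 2 / 2 + 2 * |u| ^ 3) := by gcongr; linarith
    _ ≤ _ := by nlinarith

/-- A `C¹` function with `L`-Lipschitz derivative is within `L ‖y - x‖²` of its first order Taylor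
polynomial. -/
theorem norm_sub_sub_fderiv_le_of_lipschitzWith {E F : Type*} [NormedAddCommGroup E]
    [NormedSpace ℝ E] [NormedAddCommGroup F] [NormedSpace ℝ F] {f : E → F} {L : ℝ≥0}
    (hf : Differentiable ℝ f) (hL : LipschitzWith L (fderiv ℝ f)) (x y : E) :
    ‖f y - f x - fderiv ℝ f x (y - x)‖ ≤ L * ‖y - x‖ ^ 2 := by
  have h := (convex_closedBall x ‖y - x‖).norm_image_sub_le_of_norm_fderiv_le'
    (f := f) (φ := fderiv ℝ f x) (C := L * ‖y - x‖) (x := x) (y := y)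
    (fun z _ => hf z) (fun z hz => ?_) (by simp) (by simp [dist_eq_norm])
  · rwa [mul_assoc, ← sq] at h
  · rw [← dist_eq_norm]
    exact (hL.dist_le_mul z x).trans (by gcongr; exact hz)

theorem relEntropy_withDensity_one_add_le {E : Type*} [MeasurableSpace E] (μ : Measure E)
    [IsProbabilityMeasure μ] {f : E → ℝ} {M ε : ℝ} (hf : Measurable f) (hM : ∀ x, |f x| ≤ M)
    (hmean : ∫ x, f x ∂μ = 0) (hε : 0 < ε) (hεM : ε * M ≤ 1 / 2) :
    relEntropy (μ.withDensity fun x => ENNReal.ofReal (1 + ε * f x)) μ ≤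
      ENNReal.ofReal (ε ^ 2 / 2 * ∫ x, f x ^ 2 ∂μ + 4 * (ε * M) ^ 3) := by
  have hu : ∀ x, |ε * f x| ≤ ε * M := fun x => by
    rw [abs_mul, abs_of_pos hε]; gcongr; exact hM x
  have hhalf : ∀ x, 1 / 2 ≤ 1 + ε * f x := fun x => by
    linarith [(abs_le.1 (hu x)).1]
  have hub : ∀ x, 1 + ε * f x ≤ 2 := fun x => by
    linarith [(abs_le.1 (hu x)).2]
  have hmeas : Measurable fun x => ENNReal.ofReal (1 + ε * f x) := by fun_prop
  have hfint : Integrable f μ := .of_bound hf.aestronglyMeasurable M (.of_forall hM)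
  have hsq : Integrable (fun x => f x ^ 2) μ :=
    .of_bound (hf.pow_const 2).aestronglyMeasurable (M ^ 2) (.of_forall fun x => by
      simpa [abs_of_nonneg] using pow_le_pow_left₀ (abs_nonneg _) (hM x) 2)
  have hlogb : ∀ x, ‖Real.log (1 + ε * f x)‖ ≤ 1 := fun x => by
    have hp : 0 < 1 + ε * f x := by linarith [hhalf x]
    rw [Real.norm_eq_abs, abs_le]
    constructor
    · have := Real.one_sub_inv_le_log_of_pos hp
      have : (1 + ε * f x)⁻¹ ≤ 2 := by
        rw [inv_le_comm₀ hp (by norm_num)]; linarith [hhalf x]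
      linarith
    · linarith [Real.log_le_sub_one_of_pos hp, hub x]
  have hlogm : Measurable fun x => Real.log (1 + ε * f x) := by fun_prop
  set ν := μ.withDensity fun x => ENNReal.ofReal (1 + ε * f x) with hν
  have hfin : IsFiniteMeasure ν :=
    isFiniteMeasure_withDensity_ofReal ((integrable_const (1 : ℝ)).add (hfint.const_mul ε)).2
  have hac : ν ≪ μ := withDensity_absolutelyContinuous _ _
  have hrn : (fun x => Real.log (ν.rnDeriv μ x).toReal) =ᵐ[ν]
      fun x => Real.log (1 + ε * f x) := by
    filter_upwards [hac (Measure.rnDeriv_withDensity μ hmeas)] with x hx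
    rw [hx, ENNReal.toReal_ofReal (by linarith [hhalf x])]
  have hlogint : Integrable (fun x => Real.log (1 + ε * f x)) ν :=
    .of_bound hlogm.aestronglyMeasurable 1 (.of_forall hlogb)
  rw [relEntropy, if_pos ⟨hac, hlogint.congr hrn.symm⟩, integral_congr_ae hrn]
  apply ENNReal.ofReal_le_ofReal
  rw [hν, integral_withDensity_eq_integral_toReal_smul hmeas (.of_forall fun _ => by simp)]
  have hprod : Integrable (fun x => (1 + ε * f x) * Real.log (1 + ε * f x)) μ :=
    .of_bound (by fun_prop) (2 * 1) (.of_forall fun x => by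
      rw [norm_mul]
      gcongr
      · rw [Real.norm_of_nonneg (by linarith [hhalf x])]; exact hub x
      · exact hlogb x)
  calc ∫ x, (ENNReal.ofReal (1 + ε * f x)).toReal • Real.log (1 + ε * f x) ∂μ
      = ∫ x, (1 + ε * f x) * Real.log (1 + ε * f x) ∂μ := by
        congr with x
        rw [ENNReal.toReal_ofReal (by linarith [hhalf x]), smul_eq_mul]
    _ ≤ ∫ x, (ε * f x + ε ^ 2 / 2 * f x ^ 2 + 4 * (ε * M) ^ 3) ∂μ := by
        refine integral_mono hprod
          (((hfint.const_mul _).add (hsq.const_mul _)).add (integrable_const _)) fun x => ?_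
        have h := one_add_mul_log_one_add_le ((hu x).trans hεM)
        have h3 := pow_le_pow_left₀ (abs_nonneg _) (hu x) 3
        simp only
        linarith
    _ = _ := by
        rw [integral_add (f := fun x => ε * f x + ε ^ 2 / 2 * f x ^ 2)
            ((hfint.const_mul _).add (hsq.const_mul _)) (integrable_const _),
          integral_add (hfint.const_mul _) (hsq.const_mul _), integral_const_mul,
          integral_const_mul, hmean]
        simp

/-- Kantorovich-type bound for the difference of the integrals of `f` against the marginals of a
coupling. -/
theorem integral_snd_sub_integral_fst_le {E : Type*} [NormedAddCommGroup E] [NormedSpace ℝ E]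
    [MeasurableSpace E] [BorelSpace E] [SecondCountableTopology E]
    {μ ν : Measure E} [IsProbabilityMeasure μ] [IsProbabilityMeasure ν] {π : Measure (E × E)}
    (h₁ : π.map Prod.fst = μ) (h₂ : π.map Prod.snd = ν) {f : E → ℝ} {a K T : ℝ} {G : E → ℝ}
    (hfμ : Integrable f μ) (hfν : Integrable f ν) (hG : Integrable G μ) (hT : 0 ≤ T)
    (hcost : ∫⁻ z, edist z.1 z.2 ^ (2 : ℝ) ∂π ≤ ENNReal.ofReal T) (hK : 0 ≤ K)
    (hf : ∀ x y, f y - f x ≤ a * G x + K * ‖y - x‖ ^ 2) :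
    ∫ x, f x ∂ν - ∫ x, f x ∂μ ≤ a * ∫ x, G x ∂μ + K * T := by
  have heq : ∀ z : E × E, edist z.1 z.2 ^ (2 : ℝ) = ENNReal.ofReal (‖z.2 - z.1‖ ^ 2) := fun z => by
    rw [edist_comm, edist_dist, dist_eq_norm,
      ENNReal.ofReal_rpow_of_nonneg (by positivity) (by norm_num)]
    norm_num
  simp_rw [heq] at hcost
  have hdm : AEStronglyMeasurable (fun z : E × E => ‖z.2 - z.1‖ ^ 2) π := by
    have : Measurable fun z : E × E => ‖z.2 - z.1‖ ^ 2 := by fun_prop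
    exact this.aestronglyMeasurable
  have hdnn : 0 ≤ᵐ[π] fun z : E × E => ‖z.2 - z.1‖ ^ 2 := .of_forall fun z => by positivity
  have hdint : Integrable (fun z : E × E => ‖z.2 - z.1‖ ^ 2) π := by
    refine ⟨hdm, ?_⟩
    rw [hasFiniteIntegral_iff_ofReal hdnn]
    exact hcost.trans_lt ENNReal.ofReal_lt_top
  have hdT : ∫ z, ‖z.2 - z.1‖ ^ 2 ∂π ≤ T := by
    rw [integral_eq_lintegral_of_nonneg_ae hdnn hdm]
    exact ENNReal.toReal_le_of_le_ofReal hT hcost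
  subst h₁ h₂
  have i₁ := hfμ.comp_measurable measurable_fst
  have i₂ := hfν.comp_measurable measurable_snd
  have i₃ := hG.comp_measurable measurable_fst
  rw [integral_map measurable_snd.aemeasurable hfν.1, integral_map measurable_fst.aemeasurable hfμ.1,
    integral_map measurable_fst.aemeasurable hG.1]
  calc ∫ z, f z.2 ∂π - ∫ z, f z.1 ∂π
      = ∫ z, (f z.2 - f z.1) ∂π := (integral_sub i₂ i₁).symm
    _ ≤ ∫ z, (a * G z.1 + K * ‖z.2 - z.1‖ ^ 2) ∂π :=
        integral_mono (i₂.sub i₁) ((i₃.const_mul a).add (hdint.const_mul K)) fun z => hf _ _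
    _ = a * ∫ z, G z.1 ∂π + K * ∫ z, ‖z.2 - z.1‖ ^ 2 ∂π := by
        rw [← integral_const_mul, ← integral_const_mul]
        exact integral_add (i₃.const_mul a) (hdint.const_mul K)
    _ ≤ _ := by gcongr

/-- Under `T_2(C)`, an entropy bound provides a coupling of almost optimal quadratic cost. -/
theorem SatisfiesTp.exists_coupling {E : Type*} [PseudoEMetricSpace E] [MeasurableSpace E]
    {C : ℝ} {μ ν : Measure E} (hT : SatisfiesTp 2 C μ) [IsProbabilityMeasure ν] {T H : ℝ}
    (hH : relEntropy ν μ ≤ ENNReal.ofReal H) (hC : 0 < C) (hT₀ : 0 < T) (hHT : 2 * C * H < T) :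
    ∃ π : Measure (E × E), π.map Prod.fst = μ ∧ π.map Prod.snd = ν ∧
      ∫⁻ z, edist z.1 z.2 ^ (2 : ℝ) ∂π ≤ ENNReal.ofReal T := by
  have h : wassersteinDist 2 μ ν < ENNReal.ofReal T ^ (1 / 2 : ℝ) := by
    refine (hT ν inferInstance).trans_lt (ENNReal.rpow_lt_rpow ?_ (by norm_num))
    calc ENNReal.ofReal (2 * C) * relEntropy ν μ
        ≤ ENNReal.ofReal (2 * C) * ENNReal.ofReal H := by gcongr
      _ = ENNReal.ofReal (2 * C * H) := (ENNReal.ofReal_mul (by positivity)).symm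
      _ < ENNReal.ofReal T := (ENNReal.ofReal_lt_ofReal_iff hT₀).2 hHT
  simp only [wassersteinDist, iInf_lt_iff] at h
  obtain ⟨π, ⟨h₁, h₂⟩, h⟩ := h
  exact ⟨π, h₁, h₂, ((ENNReal.rpow_lt_rpow_iff (by norm_num)).1 h).le⟩

/-- Linearization of `T_2(C)` along the perturbation `(1 + ε f) μ`. -/
theorem SatisfiesTp.integral_sq_le {E : Type*} [NormedAddCommGroup E] [NormedSpace ℝ E]
    [MeasurableSpace E] [BorelSpace E] [SecondCountableTopology E] {μ : Measure E}
    [IsProbabilityMeasure μ] {C : ℝ} (hC : 0 < C) (hT : SatisfiesTp 2 C μ) {f : E → ℝ} {M ε : ℝ}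
    {L : ℝ≥0} (hf : Differentiable ℝ f) (hL : LipschitzWith L (fderiv ℝ f))
    (hG : Integrable (fun x => ‖fderiv ℝ f x‖ ^ 2) μ) (hfm : Measurable f) (hM : ∀ x, |f x| ≤ M)
    (hmean : ∫ x, f x ∂μ = 0) (hε : 0 < ε) (hεM : ε * M ≤ 1 / 2) :
    ∫ x, f x ^ 2 ∂μ ≤ C / 2 * ∫ x, ‖fderiv ℝ f x‖ ^ 2 ∂μ +
      (1 / 2 + L * C * ε) * (∫ x, f x ^ 2 ∂μ + (8 * M ^ 3 + 1) * ε) := by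
  have hpos : ∀ x, 0 ≤ 1 + ε * f x := fun x => by
    have : |ε * f x| ≤ ε * M := by rw [abs_mul, abs_of_pos hε]; gcongr; exact hM x
    linarith [(abs_le.1 this).1]
  have hfint : Integrable f μ := .of_bound hfm.aestronglyMeasurable M (.of_forall hM)
  have hsq : Integrable (fun x => f x ^ 2) μ :=
    .of_bound (hfm.pow_const 2).aestronglyMeasurable (M ^ 2) (.of_forall fun x => by
      simpa [abs_of_nonneg] using pow_le_pow_left₀ (abs_nonneg _) (hM x) 2)
  have hM₀ : 0 ≤ M := (abs_nonneg _).trans (hM 0)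
  have hV₀ : 0 ≤ ∫ x, f x ^ 2 ∂μ := integral_nonneg fun x => by positivity
  have hmeas : Measurable fun x => ENNReal.ofReal (1 + ε * f x) := by fun_prop
  have hdens : Integrable (fun x => 1 + ε * f x) μ :=
    (integrable_const (1 : ℝ)).add (hfint.const_mul ε)
  have hent := relEntropy_withDensity_one_add_le μ hfm hM hmean hε hεM
  set ν := μ.withDensity fun x => ENNReal.ofReal (1 + ε * f x) with hν
  have hprob : IsProbabilityMeasure ν := ⟨by
    rw [hν, withDensity_apply _ .univ, Measure.restrict_univ,
      ← ofReal_integral_eq_lintegral_ofReal hdens (.of_forall hpos),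
      integral_add (integrable_const _) (hfint.const_mul ε), integral_const_mul, hmean]
    simp⟩
  have hfν : ∫ x, f x ∂ν = ε * ∫ x, f x ^ 2 ∂μ := by
    rw [hν, integral_withDensity_eq_integral_toReal_smul hmeas (.of_forall fun _ => by simp)]
    calc ∫ x, (ENNReal.ofReal (1 + ε * f x)).toReal • f x ∂μ
        = ∫ x, (f x + ε * f x ^ 2) ∂μ := by
          congr with x
          rw [ENNReal.toReal_ofReal (hpos x), smul_eq_mul]
          ring
      _ = _ := by rw [integral_add hfint (hsq.const_mul ε), integral_const_mul, hmean, zero_add]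
  set V := ∫ x, f x ^ 2 ∂μ
  set T := ε ^ 2 * C * (V + (8 * M ^ 3 + 1) * ε) with hTdef
  have hT₀ : 0 < T := by positivity
  obtain ⟨π, h₁, h₂, hcost⟩ := hT.exists_coupling hent hC hT₀ (by
    have : 0 < ε ^ 3 * C := by positivity
    rw [hTdef]; linarith)
  have key := integral_snd_sub_integral_fst_le h₁ h₂ hfint
    (.of_bound hfm.aestronglyMeasurable M (.of_forall hM)) hG hT₀.le hcost
    (a := ε * C / 2) (K := 1 / (2 * ε * C) + L) (by positivity) (fun x y => by
      have hTaylor := (le_abs_self _).trans (norm_sub_sub_fderiv_le_of_lipschitzWith hf hL x y)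
      have hop := (le_abs_self _).trans ((fderiv ℝ f x).le_opNorm (y - x))
      have hamgm : ‖fderiv ℝ f x‖ * ‖y - x‖ ≤
          ε * C / 2 * ‖fderiv ℝ f x‖ ^ 2 + 1 / (2 * ε * C) * ‖y - x‖ ^ 2 := by
        rw [← sub_nonneg]
        have : ε * C / 2 * ‖fderiv ℝ f x‖ ^ 2 + 1 / (2 * ε * C) * ‖y - x‖ ^ 2
            - ‖fderiv ℝ f x‖ * ‖y - x‖ =
            1 / (2 * ε * C) * (ε * C * ‖fderiv ℝ f x‖ - ‖y - x‖) ^ 2 := by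
          field_simp; ring
        rw [this]; positivity
      linarith)
  rw [hfν, hmean, sub_zero] at key
  refine le_of_mul_le_mul_left (key.trans_eq ?_) hε
  rw [hTdef]
  field_simp

theorem T2_poincare (d : ℕ) (μ : Measure (EuclideanSpace ℝ (Fin d)))
    [IsProbabilityMeasure μ] (C : ℝ) (hC : 0 < C) (hT : SatisfiesTp 2 C μ)
    (g : EuclideanSpace ℝ (Fin d) → ℝ) (hg : ContDiff ℝ (⊤ : ℕ∞) g)
    (hsupp : HasCompactSupport g) :
    (∫ x, g x ^ 2 ∂μ) - (∫ x, g x ∂μ) ^ 2 ≤ C * ∫ x, ‖fderiv ℝ g x‖ ^ 2 ∂μ := by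
  have hg' : ContDiff ℝ 1 (fderiv ℝ g) := hg.fderiv_right (by norm_cast)
  obtain ⟨L, hL⟩ := hg'.lipschitzWith_of_hasCompactSupport (hsupp.fderiv ℝ) one_ne_zero
  obtain ⟨B, hB⟩ := hsupp.exists_bound_of_continuous hg.continuous
  obtain ⟨B', hB'⟩ := (hsupp.fderiv ℝ).exists_bound_of_continuous hg'.continuous
  have hgint : Integrable g μ :=
    .of_bound hg.continuous.aestronglyMeasurable B (.of_forall hB)
  have hgsq : Integrable (fun x => g x ^ 2) μ :=
    .of_bound (hg.continuous.pow 2).aestronglyMeasurable (B ^ 2) (.of_forall fun x => by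
      rw [norm_pow]; exact pow_le_pow_left₀ (norm_nonneg _) (hB x) 2)
  have hG : Integrable (fun x => ‖fderiv ℝ g x‖ ^ 2) μ :=
    .of_bound (hg'.continuous.norm.pow 2).aestronglyMeasurable (B' ^ 2) (.of_forall fun x => by
      rw [norm_pow, norm_norm]; exact pow_le_pow_left₀ (norm_nonneg _) (hB' x) 2)
  set m := ∫ x, g x ∂μ with hm
  set f := fun x => g x - m with hf
  have hfd : fderiv ℝ f = fderiv ℝ g := by ext1 x; simp [hf, fderiv_sub_const]
  have hfc : Continuous f := hg.continuous.sub continuous_const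
  have hmean : ∫ x, f x ∂μ = 0 := by
    rw [hf, integral_sub hgint (integrable_const _)]; simp [hm]
  have hvar : ∫ x, f x ^ 2 ∂μ = ∫ x, g x ^ 2 ∂μ - m ^ 2 := by
    calc ∫ x, f x ^ 2 ∂μ = ∫ x, (g x ^ 2 - 2 * m * g x + m ^ 2) ∂μ := by
          congr with x; simp only [hf]; ring
      _ = _ := by
          rw [integral_add (f := fun x => g x ^ 2 - 2 * m * g x)
              (hgsq.sub (hgint.const_mul _)) (integrable_const _),
            integral_sub hgsq (hgint.const_mul _), integral_const_mul, ← hm]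
          simp; ring
  have hM : ∀ x, |f x| ≤ B + |m| := fun x =>
    (norm_sub_le _ _).trans (add_le_add_left (hB x) _)
  have hM₀ : 0 ≤ B + |m| := (abs_nonneg _).trans (hM 0)
  rw [← hvar, ← hfd]
  set M := B + |m|
  set V := ∫ x, f x ^ 2 ∂μ
  set G := ∫ x, ‖fderiv ℝ f x‖ ^ 2 ∂μ
  have hlim : Filter.Tendsto (fun ε : ℝ => C / 2 * G +
      (1 / 2 + L * C * ε) * (V + (8 * M ^ 3 + 1) * ε)) (nhdsWithin 0 (Set.Ioi 0))
      (nhds (C / 2 * G + (1 / 2 + L * C * 0) * (V + (8 * M ^ 3 + 1) * 0))) :=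
    (Continuous.tendsto (by fun_prop) 0).mono_left nhdsWithin_le_nhds
  have hev : ∀ᶠ ε : ℝ in nhdsWithin 0 (Set.Ioi 0), ε * M ≤ 1 / 2 := by
    have : Filter.Tendsto (fun ε : ℝ => ε * M) (nhdsWithin 0 (Set.Ioi 0)) (nhds (0 * M)) :=
      (Continuous.tendsto (by fun_prop) 0).mono_left nhdsWithin_le_nhds
    exact this.eventually_le_const (by norm_num)
  have hle : V ≤ C / 2 * G + (1 / 2 + L * C * 0) * (V + (8 * M ^ 3 + 1) * 0) := by
    refine ge_of_tendsto hlim ?_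
    filter_upwards [hev, self_mem_nhdsWithin] with ε hεM hε
    exact hT.integral_sq_le hC ((hg.differentiable (by simp)).sub_const m) (hfd ▸ hL) (hfd ▸ hG)
      hfc.measurable hM hmean hε hεM
  linarith
end
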